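/- There are no integers t, c with c ≠ 0 such that c^2 = -2t^3 + t; equivalently, the only integral points (X, Y) on Y^2 = X^3 - 2X with Y > 0 are (-1,1), (2,2), and (338, 6214), and none of these yields an integer d with 3t^2 - 4d = 1 where X = -2t. -/

import Mathlib

open Finset


def qq (c k : ℕ) : ℕ := 2 ^ k * (∏ i ∈ range k, (c + 4 * i)) / k.factorial

theorem fact_dvd (c k : ℕ) : k.factorial ∣ 2 ^ k * ∏ i ∈ range k, (c + 4 * i) := by
  obtain ⟨v, m, hm, h⟩ := Nat.exists_eq_two_pow_mul_odd (Nat.factorial_ne_zero k)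
  rw [h]
  apply mul_dvd_mul
  · apply pow_dvd_pow
    by_contra hlt
    push Not at hlt
    have h1 : 2 ^ v ∣ k.factorial := by rw [h]; exact dvd_mul_right _ _
    rcases Nat.eq_zero_or_pos k with hk | hk
    · subst hk
      have h2 := (pow_dvd_pow 2 hlt).trans h1
      simp at h2
    · have h2 := Nat.emultiplicity_two_factorial_lt (n := k) hk.ne'
      have h3 := le_emultiplicity_of_pow_dvd h1
      have h4 := lt_of_le_of_lt h3 h2
      have h5 : v < k := by exact_mod_cast h4
      omega
  · have hc : Nat.Coprime 4 m := by
      have : Nat.Coprime 2 m := (Nat.coprime_two_left).2 hm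
      exact Nat.Coprime.pow_left 2 this
    have hs : ∃ s : ℕ, 4 * s ≡ c [MOD m] := by
      have hm0 : NeZero m := ⟨by rintro rfl; simp at hm⟩
      refine ⟨((4:ZMod m)⁻¹ * c).val, ?_⟩
      rw [← ZMod.natCast_eq_natCast_iff]
      push_cast
      rw [ZMod.natCast_val, ZMod.cast_id', id, ← mul_assoc]
      have := ZMod.coe_mul_inv_eq_one 4 hc
      push_cast at this
      rw [this, one_mul]
    obtain ⟨s, hs⟩ := hs
    have h1 : ∏ i ∈ range k, (c + 4 * i) ≡ ∏ i ∈ range k, (4 * (s + i)) [MOD m] := by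
      rw [← ZMod.natCast_eq_natCast_iff] at hs ⊢
      push_cast at hs ⊢
      apply prod_congr rfl
      intro i _
      rw [← hs]; ring
    rw [(h1.dvd_iff dvd_rfl)]
    rw [prod_mul_distrib]
    apply Dvd.dvd.mul_left
    have h2 := Nat.factorial_dvd_ascFactorial s k
    rw [Nat.ascFactorial_eq_prod_range] at h2
    exact (Dvd.intro_left _ h.symm).trans h2

theorem qq_mul (c k : ℕ) : (qq c k : ℂ) * (k.factorial : ℂ) = 2 ^ k * ∏ i ∈ range k, ((c:ℂ) + 4 * i) := by
  have := Nat.div_mul_cancel (fact_dvd c k)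
  unfold qq
  exact_mod_cast congrArg (Nat.cast : ℕ → ℂ) this

def ee (r j : ℕ) : ℕ := qq (4 * j + 3) (r - j) * qq (4 * (r - j) + 5) j

theorem four_ne (z : ℤ) : (4 * (z:ℂ) + 1) ≠ 0 := by
  have : 4 * z + 1 ≠ 0 := by omega
  exact_mod_cast this

theorem pfrac (r : ℕ) : ∀ z : ℤ, ∑ l ∈ range (r+1), (-1:ℂ)^l * (r.choose l : ℂ) / (4 * ((z + l : ℤ):ℂ) + 1)
    = 4 ^ r * r.factorial / ∏ l ∈ range (r+1), (4 * ((z + l : ℤ):ℂ) + 1) := by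
  induction r with
  | zero => intro z; simp
  | succ r ih =>
    intro z
    have key : ∑ l ∈ range (r+1+1), (-1:ℂ)^l * ((r+1).choose l : ℂ) / (4 * ((z + l : ℤ):ℂ) + 1)
      = (∑ l ∈ range (r+1), (-1:ℂ)^l * (r.choose l : ℂ) / (4 * ((z + l : ℤ):ℂ) + 1)) -
       ∑ l ∈ range (r+1), (-1:ℂ)^l * (r.choose l : ℂ) / (4 * ((z + 1 + l : ℤ):ℂ) + 1) := by
      have e1 : ∑ l ∈ range (r+1), (-1:ℂ)^l * (r.choose l : ℂ) / (4 * ((z + l : ℤ):ℂ) + 1)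
         = ∑ l ∈ range (r+1+1), (-1:ℂ)^l * (r.choose l : ℂ) / (4 * ((z + l : ℤ):ℂ) + 1) := by
        rw [sum_range_succ _ (r+1)]; simp
      rw [e1, sum_range_succ' _ (r+1), sum_range_succ' _ (r+1)]
      rw [add_sub_right_comm, ← sum_sub_distrib]
      congr 1
      · apply sum_congr rfl
        intro l _
        rw [Nat.choose_succ_succ]
        have : ((z + 1 + l : ℤ) : ℂ) = ((z + (l+1 : ℕ) : ℤ) : ℂ) := by push_cast; ring
        rw [this]
        push_cast
        ring
      · simp
    rw [key, ih, ih]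
    have p1 : ∏ l ∈ range (r+1+1), (4 * ((z + l : ℤ):ℂ) + 1) =
      (∏ l ∈ range (r+1), (4 * ((z + l : ℤ):ℂ) + 1)) * (4 * ((z + (r+1:ℕ) : ℤ):ℂ) + 1) := prod_range_succ _ _
    have p2 : ∏ l ∈ range (r+1+1), (4 * ((z + l : ℤ):ℂ) + 1) =
      (∏ l ∈ range (r+1), (4 * ((z + 1 + l : ℤ):ℂ) + 1)) * (4 * (z:ℂ) + 1) := by
      rw [prod_range_succ']
      congr 1
      · apply prod_congr rfl
        intro l _
        push_cast; ring
      · simp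
    have n1 : ∏ l ∈ range (r+1), (4 * ((z + l : ℤ):ℂ) + 1) ≠ 0 := prod_ne_zero_iff.2 fun l _ => four_ne _
    have n2 : ∏ l ∈ range (r+1), (4 * ((z + 1 + l : ℤ):ℂ) + 1) ≠ 0 := prod_ne_zero_iff.2 fun l _ => four_ne _
    have n3 : ∏ l ∈ range (r+1+1), (4 * ((z + l : ℤ):ℂ) + 1) ≠ 0 := prod_ne_zero_iff.2 fun l _ => four_ne _
    have n4 := four_ne (z + (r+1:ℕ))
    have n5 := four_ne z
    have q1 : (∏ l ∈ range (r+1), (4 * ((z + l : ℤ):ℂ) + 1))⁻¹ = (4 * ((z + (r+1:ℕ) : ℤ):ℂ) + 1) / ∏ l ∈ range (r+1+1), (4 * ((z + l : ℤ):ℂ) + 1) := by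
      rw [p1]; field_simp
    have q2 : (∏ l ∈ range (r+1), (4 * ((z + 1 + l : ℤ):ℂ) + 1))⁻¹ = (4 * (z:ℂ) + 1) / ∏ l ∈ range (r+1+1), (4 * ((z + l : ℤ):ℂ) + 1) := by
      rw [p2]; field_simp
    rw [div_eq_mul_inv _ (∏ l ∈ range (r+1), (4 * ((z + l : ℤ):ℂ) + 1)), q1,
      div_eq_mul_inv _ (∏ l ∈ range (r+1), (4 * ((z + 1 + l : ℤ):ℂ) + 1)), q2, Nat.factorial_succ]
    field_simp
    push_cast
    ring

/-- normalising constant -/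
noncomputable def cc (r : ℕ) : ℂ := 2 ^ r * (∏ i ∈ range r, ((3:ℂ) + 4 * i)) * (∏ i ∈ range r, ((5:ℂ) + 4 * i)) / (r.factorial ^ 2 * 4 ^ r)

noncomputable def aa (r j : ℕ) : ℂ := (-1)^j * (r.choose j : ℂ) *
  ∑ l ∈ range (r+1), (-1:ℂ)^l * (r.choose l : ℂ) / (4 * ((-j + l : ℤ):ℂ) + 1)

theorem cc_norm (r : ℕ) : ‖cc r‖ ≤ 8 ^ r := by
  have : ∀ r, cc (r+1) = cc r * ((2 * (3 + 4 * r) * (5 + 4 * r)) / ((r+1)^2 * 4)) := by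
    intro r
    unfold cc
    rw [prod_range_succ, prod_range_succ, Nat.factorial_succ]
    have : (r.factorial : ℂ) ≠ 0 := by exact_mod_cast r.factorial_ne_zero
    have h2 : (r + 1 : ℂ) ≠ 0 := by exact_mod_cast r.succ_ne_zero
    push_cast
    field_simp
    ring
  induction r with
  | zero => simp [cc]
  | succ r ih =>
    rw [this, norm_mul, pow_succ (8:ℝ)]
    apply mul_le_mul ih _ (norm_nonneg _) (by positivity)
    have : ((2 * (3 + 4 * r) * (5 + 4 * r)) / ((r+1)^2 * 4) : ℂ) = (((2 * (3 + 4 * r) * (5 + 4 * r)) / ((r+1)^2 * 4) : ℝ) : ℂ) := by push_cast; rfl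
    rw [this, Complex.norm_real, Real.norm_of_nonneg (by positivity), div_le_iff₀ (by positivity)]
    nlinarith

theorem cc_aa (r j : ℕ) (hj : j ≤ r) : cc r * aa r j = ee r j := by
  obtain ⟨k, rfl⟩ := Nat.exists_eq_add_of_le hj
  unfold aa
  rw [pfrac]
  have hp : ∏ l ∈ range (j + k + 1), (4 * ((-j + l : ℤ):ℂ) + 1) =
     (-1)^j * (∏ i ∈ range j, ((3:ℂ) + 4 * i)) * (∏ i ∈ range k, ((5:ℂ) + 4 * i)) := by
    rw [add_assoc, prod_range_add, prod_range_succ', ← prod_range_reflect]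
    have : ∏ l ∈ range j, (4 * ((-j + (j - 1 - l : ℕ) : ℤ):ℂ) + 1) = (-1)^j * (∏ i ∈ range j, ((3:ℂ) + 4 * i)) := by
      have := prod_const (s := range j) (-1:ℂ)
      rw [card_range] at this
      rw [← this, ← prod_mul_distrib]
      apply prod_congr rfl
      intro l hl
      rw [mem_range] at hl
      have : (-j + (j - 1 - l : ℕ) : ℤ) = - 1 - l := by omega
      rw [this]; push_cast; ring
    rw [this]
    congr 1
    simp
    apply prod_congr rfl
    intro l _
    ring
  rw [hp]
  unfold cc ee
  rw [Nat.add_sub_cancel_left]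
  have h1 := qq_mul (4 * j + 3) k
  have h2 := qq_mul (4 * k + 5) j
  have s1 : ∏ i ∈ range (j + k), ((3:ℂ) + 4 * i) = (∏ i ∈ range j, ((3:ℂ) + 4 * i)) * ∏ i ∈ range k, (((4 * j + 3 : ℕ) :ℂ) + 4 * i) := by
    rw [prod_range_add]; congr 1; apply prod_congr rfl; intro i _; push_cast; ring
  have s2 : ∏ i ∈ range (j + k), ((5:ℂ) + 4 * i) = (∏ i ∈ range k, ((5:ℂ) + 4 * i)) * ∏ i ∈ range j, (((4 * k + 5 : ℕ) :ℂ) + 4 * i) := by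
    rw [add_comm j k, prod_range_add]; congr 1; apply prod_congr rfl; intro i _; push_cast; ring
  have f1 : (j.factorial : ℂ) ≠ 0 := by exact_mod_cast j.factorial_ne_zero
  have f2 : (k.factorial : ℂ) ≠ 0 := by exact_mod_cast k.factorial_ne_zero
  have f3 : ((j+k).factorial : ℂ) ≠ 0 := by exact_mod_cast (j+k).factorial_ne_zero
  have hch : ((j+k).choose j : ℂ) * j.factorial * k.factorial = (j+k).factorial := by
    have := Nat.add_choose_mul_factorial_mul_factorial j k
    rw [← Nat.choose_symm_add] at this
    exact_mod_cast this
  have n1 : ∏ i ∈ range j, ((3:ℂ) + 4 * i) ≠ 0 := prod_ne_zero_iff.2 fun l _ => by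
    norm_cast; omega
  have n2 : ∏ i ∈ range k, ((5:ℂ) + 4 * i) ≠ 0 := prod_ne_zero_iff.2 fun l _ => by
    norm_cast; omega
  rw [s1, s2]
  push_cast at h1 h2 ⊢
  have g1 : ∏ i ∈ range k, (4 * (j:ℂ) + 3 + 4 * i) = qq (4 * j + 3) k * k.factorial / 2 ^ k := by
    rw [h1]; field_simp
  have g2 : ∏ i ∈ range j, (4 * (k:ℂ) + 5 + 4 * i) = qq (4 * k + 5) j * j.factorial / 2 ^ j := by
    rw [h2]; field_simp
  rw [g1, g2, ← hch]
  rw [← hch] at f3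
  have f4 : ((j+k).choose j : ℂ) ≠ 0 := by
    intro h; rw [h] at f3; simp at f3
  have m1 : ((-1:ℂ)^j) ≠ 0 := by simp
  rw [pow_add, pow_add]
  field_simp


noncomputable def Ap (r : ℕ) (x : ℂ) : ℂ := ∑ j ∈ range (r+1), (ee r j : ℂ) * x ^ j
noncomputable def Bp (r : ℕ) (x : ℂ) : ℂ := ∑ j ∈ range (r+1), (ee r (r-j) : ℂ) * x ^ j

theorem bb_eq (r l : ℕ) (hl : l ≤ r) : (-1:ℂ)^l * (r.choose l : ℂ) *
    ∑ j ∈ range (r+1), (-1:ℂ)^j * (r.choose j : ℂ) / (4 * ((l - j : ℤ):ℂ) + 1) = aa r (r-l) := by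
  unfold aa
  rw [Nat.choose_symm hl, ← sum_range_reflect, mul_sum, mul_sum]
  apply sum_congr rfl
  intro j hj
  rw [mem_range] at hj
  have hj' : j ≤ r := by omega
  have e1 : r + 1 - 1 - j = r - j := by omega
  rw [e1, Nat.choose_symm hj']
  have e2 : ((l:ℤ) - ((r - j : ℕ):ℤ)) = (-((r - l : ℕ):ℤ) + (j:ℤ)) := by omega
  rw [e2]
  have e3 : (-1:ℂ)^l * (-1)^(r-j) = (-1)^(r-l) * (-1)^j := by
    rw [← pow_add, ← pow_add]
    rcases Nat.even_or_odd (l + (r - j)) with h | h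
    · rw [h.neg_one_pow, Even.neg_one_pow]
      rw [Nat.even_iff] at *; omega
    · rw [h.neg_one_pow, Odd.neg_one_pow]
      rw [Nat.odd_iff] at *; omega
  linear_combination (r.choose l : ℂ) * (r.choose j : ℂ) / (4 * ((-((r - l : ℕ):ℤ) + (j:ℤ) : ℤ):ℂ) + 1) * e3

theorem binom_alt (r : ℕ) (x : ℂ) : ∑ j ∈ range (r+1), (-1:ℂ)^j * (r.choose j : ℂ) * x ^ j = (1 - x)^r := by
  have := add_pow (-x) 1 r
  rw [show (1 - x) = -x + 1 by ring, this]
  apply sum_congr rfl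
  intro j _
  rw [neg_pow]; ring

noncomputable def GG (r : ℕ) (w u : ℂ) : ℂ := ∑ j ∈ range (r+1), ∑ l ∈ range (r+1),
  ((-1:ℂ)^j * (r.choose j : ℂ) * w ^ (4 * j)) * ((-1:ℂ)^l * (r.choose l : ℂ)) *
    (u ^ (4 * (l - j : ℤ) + 1) / (4 * ((l - j : ℤ):ℂ) + 1))

theorem GG_deriv (r : ℕ) (w u : ℂ) (hu : u ≠ 0) :
    HasDerivAt (GG r w) (((1 - w^4/u^4) * (1 - u^4))^r) u := by
  have h : ((1 - w^4/u^4) * (1 - u^4))^r = ∑ j ∈ range (r+1), ∑ l ∈ range (r+1),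
      ((-1:ℂ)^j * (r.choose j : ℂ) * w ^ (4 * j)) * ((-1:ℂ)^l * (r.choose l : ℂ)) *
    (((4 * (l - j : ℤ) + 1 : ℤ) * u ^ (4 * (l - j : ℤ) + 1 - 1)) / (4 * ((l - j : ℤ):ℂ) + 1)) := by
    rw [mul_pow, ← binom_alt, ← binom_alt, sum_mul_sum]
    apply sum_congr rfl; intro j _
    apply sum_congr rfl; intro l _
    have n := four_ne (l - j : ℤ)
    have e : u ^ (4 * (l - j : ℤ) + 1 - 1) = (u^4)^l / (u^4)^j := by
      rw [show (4 * (l - j : ℤ) + 1 - 1) = ((4 * l : ℕ) : ℤ) - ((4 * j : ℕ) : ℤ) by push_cast; ring, zpow_sub₀ hu,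
        zpow_natCast, zpow_natCast, pow_mul, pow_mul]
    rw [e]
    push_cast at n ⊢
    rw [mul_div_cancel_left₀ _ n]
    rw [div_pow, pow_mul]
    ring
  rw [h]
  unfold GG
  apply HasDerivAt.fun_sum; intro j _
  apply HasDerivAt.fun_sum; intro l _
  apply HasDerivAt.const_mul
  apply HasDerivAt.div_const
  exact hasDerivAt_zpow _ _ (Or.inl hu)

theorem GG_one (r : ℕ) (w : ℂ) : cc r * GG r w 1 = Ap r (w^4) := by
  unfold GG Ap
  rw [mul_sum]
  apply sum_congr rfl; intro j hj
  rw [mem_range] at hj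
  rw [← cc_aa r j (by omega)]
  unfold aa
  simp only [mul_sum, sum_mul]
  apply sum_congr rfl; intro l _
  rw [one_zpow, show (-(j:ℤ) + l) = (l - j : ℤ) by ring, pow_mul]
  ring

theorem GG_self (r : ℕ) (w : ℂ) (hw : w ≠ 0) : cc r * GG r w w = w * Bp r (w^4) := by
  unfold GG Bp
  rw [sum_comm, mul_sum, mul_sum]
  apply sum_congr rfl; intro l hl
  rw [mem_range] at hl
  rw [← cc_aa r (r-l) (by omega), ← bb_eq r l (by omega)]
  simp only [mul_sum, sum_mul]
  apply sum_congr rfl; intro j _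
  have e : w ^ (4 * (l - j : ℤ) + 1) = w * (w ^ (4 * l)) / w ^ (4 * j) := by
    rw [show (4 * (l - j : ℤ) + 1) = ((4 * l : ℕ) : ℤ) - ((4 * j : ℕ) : ℤ) + 1 by push_cast; ring, zpow_add₀ hw, zpow_sub₀ hw,
        zpow_natCast, zpow_natCast, zpow_one]
    ring
  rw [e, ← pow_mul]
  have n := four_ne (l - j : ℤ)
  have : w ^ (4 * j) ≠ 0 := pow_ne_zero _ hw
  field_simp

theorem L3 (r : ℕ) (w : ℂ) (M : ℝ) (hM : ∀ u ∈ segment ℝ 1 w, u ≠ 0 ∧ ‖(1 - w^4/u^4) * (1 - u^4)‖ ≤ M) :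
    ‖w * Bp r (w^4) - Ap r (w^4)‖ ≤ 8 ^ r * (M ^ r * ‖w - 1‖) := by
  have hw := (hM w (right_mem_segment _ _ _)).1
  rw [← GG_one, ← GG_self r w hw, ← mul_sub, norm_mul]
  apply mul_le_mul (cc_norm r) _ (norm_nonneg _) (by positivity)
  apply Convex.norm_image_sub_le_of_norm_hasDerivWithin_le (s := segment ℝ 1 w) (f' := fun u => ((1 - w^4/u^4) * (1 - u^4))^r)
  · intro u hu
    exact (GG_deriv r w u (hM u hu).1).hasDerivWithinAt
  · intro u hu
    rw [norm_pow]
    exact pow_le_pow_left₀ (norm_nonneg _) (hM u hu).2 r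
  · exact convex_segment _ _
  · exact left_mem_segment _ _ _
  · exact right_mem_segment _ _ _

theorem L3' (r : ℕ) (w : ℂ) (d : ℝ) (hd : ‖w - 1‖ ≤ d) (hd1 : d ≤ 1/2) :
    ‖w * Bp r (w^4) - Ap r (w^4)‖ ≤ 8 ^ r * ((4 * d^2 * (1 + d)^6 / (1 - d)^4) ^ r * ‖w - 1‖) := by
  have hd0 : 0 ≤ d := (norm_nonneg _).trans hd
  apply L3
  intro u hu
  rw [segment_eq_image'] at hu
  obtain ⟨s, ⟨hs0, hs1⟩, rfl⟩ := hu
  simp only [Complex.real_smul]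
  set u : ℂ := 1 + (s:ℂ) * (w - 1) with hu
  have u1 : ‖u - 1‖ ≤ s * d := by
    rw [hu, add_sub_cancel_left, norm_mul, Complex.norm_real, Real.norm_of_nonneg hs0]
    exact mul_le_mul_of_nonneg_left hd hs0
  have u2 : ‖w - u‖ ≤ (1 - s) * d := by
    have : w - u = ((1 - s : ℝ) : ℂ) * (w - 1) := by rw [hu]; push_cast; ring
    rw [this, norm_mul, Complex.norm_real, Real.norm_of_nonneg (by linarith)]
    exact mul_le_mul_of_nonneg_left hd (by linarith)
  have u1' : ‖u - 1‖ ≤ d := u1.trans (by nlinarith)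
  have ul : 1 - d ≤ ‖u‖ := by
    have := norm_sub_norm_le (1:ℂ) (1 - u)
    rw [norm_one, norm_sub_rev 1 u] at this
    simp at this
    linarith
  have uu : ‖u‖ ≤ 1 + d := by
    have := norm_add_le (1:ℂ) (u - 1)
    rw [norm_one] at this
    simp at this
    linarith
  have wu : ‖w‖ ≤ 1 + d := by
    have := norm_add_le (1:ℂ) (w - 1)
    rw [norm_one] at this
    simp at this
    linarith
  have u0 : 0 < ‖u‖ := by linarith
  have hu0 : u ≠ 0 := norm_pos_iff.1 u0
  refine ⟨hu0, ?_⟩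
  have gen : ∀ a b : ℂ, ‖a‖ ≤ 1 + d → ‖b‖ ≤ 1 + d → ‖a^3 + a^2*b + a*b^2 + b^3‖ ≤ 4 * (1+d)^3 := by
    intro a b ha hb
    calc _ ≤ ‖a^3‖ + ‖a^2*b‖ + ‖a*b^2‖ + ‖b^3‖ := norm_add₄_le
      _ = ‖a‖^3 + ‖a‖^2*‖b‖ + ‖a‖*‖b‖^2 + ‖b‖^3 := by simp
      _ ≤ (1+d)^3 + (1+d)^2*(1+d) + (1+d)*(1+d)^2 + (1+d)^3 := by gcongr
      _ = _ := by ring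
  have f1 : ‖1 - u^4‖ ≤ (s * d) * (4 * (1+d)^3) := by
    have : 1 - u^4 = -((u - 1) * (u^3+u^2*1+u*1^2+1^3)) := by ring
    rw [this, norm_neg, norm_mul]
    exact mul_le_mul u1 (gen u 1 uu (by simp; linarith)) (norm_nonneg _) (by positivity)
  have f2 : ‖w^4 - u^4‖ ≤ ((1 - s) * d) * (4 * (1+d)^3) := by
    have : w^4 - u^4 = (w - u) * (w^3+w^2*u+w*u^2+u^3) := by ring
    rw [this, norm_mul]
    exact mul_le_mul u2 (gen w u wu uu) (norm_nonneg _) (mul_nonneg (by linarith) hd0)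
  have f3 : (1 - w^4/u^4) * (1 - u^4) = - ((w^4 - u^4) * (1 - u^4) / u^4) := by
    field_simp; ring
  rw [f3, norm_neg, norm_div, norm_mul, norm_pow]
  have hs4 : s * (1 - s) ≤ 1/4 := by nlinarith [sq_nonneg (s - 1/2)]
  apply div_le_div₀ (by positivity) _ (by apply pow_pos; linarith) (pow_le_pow_left₀ (by linarith) ul 4)
  calc _ ≤ (((1 - s) * d) * (4 * (1+d)^3)) * ((s * d) * (4 * (1+d)^3)) := mul_le_mul f2 f1 (norm_nonneg _) ((norm_nonneg _).trans f2)
    _ = (s * (1 - s)) * (16 * d^2 * (1+d)^6) := by ring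
    _ ≤ 1/4 * (16 * d^2 * (1+d)^6) := mul_le_mul_of_nonneg_right hs4 (by positivity)
    _ = _ := by ring


open Polynomial in
theorem det_ne (r : ℕ) (x : ℂ) (hx : x ≠ 1) : Ap r x * Bp (r+1) x - Ap (r+1) x * Bp r x ≠ 0 := by
  let PA : ℕ → ℂ[X] := fun r => ∑ j ∈ range (r+1), C (ee r j : ℂ) * X ^ j
  let PB : ℕ → ℂ[X] := fun r => ∑ j ∈ range (r+1), C (ee r (r-j) : ℂ) * X ^ j
  have hPA : ∀ r x, (PA r).eval x = Ap r x := by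
    intro r x; simp [PA, Ap, eval_finsetSum]
  have hPB : ∀ r x, (PB r).eval x = Bp r x := by
    intro r x; simp [PB, Bp, eval_finsetSum]
  have dA : ∀ r, (PA r).natDegree ≤ r := by
    intro r
    apply natDegree_sum_le_of_forall_le
    intro j hj
    rw [mem_range] at hj
    exact (natDegree_C_mul_X_pow_le _ _).trans (by omega)
  have dB : ∀ r, (PB r).natDegree ≤ r := by
    intro r
    apply natDegree_sum_le_of_forall_le
    intro j hj
    rw [mem_range] at hj
    exact (natDegree_C_mul_X_pow_le _ _).trans (by omega)
  set D : ℂ[X] := PA r * PB (r+1) - PA (r+1) * PB r with hD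
  have hDe : ∀ x, D.eval x = Ap r x * Bp (r+1) x - Ap (r+1) x * Bp r x := by
    intro x; rw [hD, eval_sub, eval_mul, eval_mul, hPA, hPB, hPA, hPB]
  have hdeg : D.natDegree ≤ 2 * r + 1 := by
    refine (natDegree_sub_le_of_le (m := 2*r+1) (n := 2*r+1) ?_ ?_).trans (by simp)
    · exact natDegree_mul_le.trans (by linarith [dA r, dB (r+1)])
    · exact natDegree_mul_le.trans (by linarith [dA (r+1), dB r])
  have hD0 : D ≠ 0 := by
    intro h
    have h0 := hDe 0
    rw [h, eval_zero] at h0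
    have A0 : ∀ r, Ap r 0 = qq 3 r := by
      intro r; unfold Ap; rw [sum_range_succ']; simp [ee, qq]
    have B0 : ∀ r, Bp r 0 = qq 5 r := by
      intro r; unfold Bp; rw [sum_range_succ']; simp [ee, qq]
    rw [A0, B0, A0, B0] at h0
    have hrec : ∀ c r, (qq c (r+1) : ℂ) * (r+1) = 2 * (c + 4 * r) * qq c r := by
      intro c r
      have f1 : (r.factorial : ℂ) ≠ 0 := by exact_mod_cast r.factorial_ne_zero
      have h1 := qq_mul c (r+1)
      rw [Nat.factorial_succ, prod_range_succ] at h1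
      have h2 := qq_mul c r
      apply mul_right_cancel₀ f1
      push_cast at h1
      linear_combination h1 - 2 * (c + 4 * r) * h2
    have nz : ∀ c r, c ≠ 0 → (qq c r : ℂ) ≠ 0 := by
      intro c r hc h
      have h2 := qq_mul c r
      rw [h, zero_mul] at h2
      have : ∏ i ∈ range r, ((c:ℂ) + 4 * i) ≠ 0 := prod_ne_zero_iff.2 fun l _ => by
        norm_cast; omega
      exact (mul_ne_zero (pow_ne_zero _ two_ne_zero) this) h2.symm
    have r3 := hrec 3 r
    have r5 := hrec 5 r
    have : (qq 3 r : ℂ) * qq 5 r * 4 = 0 := by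
      push_cast at r3 r5
      linear_combination qq 5 r * r3 - qq 3 r * r5 - (r+1) * h0
    exact mul_ne_zero (mul_ne_zero (nz 3 r (by norm_num)) (nz 5 r (by norm_num))) (by norm_num) this
  obtain ⟨G, hG, hG1⟩ := exists_eq_pow_rootMultiplicity_mul_and_not_dvd D hD0 1
  set k := rootMultiplicity 1 D with hk
  rw [dvd_iff_isRoot, IsRoot.def] at hG1
  have hk2 : 2 * r + 1 ≤ k := by
    by_contra hlt
    push Not at hlt
    apply hG1
    obtain ⟨m, hm⟩ : ∃ m, 2 * r + 1 = k + (m + 1) := ⟨2 * r - k, by omega⟩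
    let K : ℝ := 4 * (1 + 1/2)^6 / (1 - 1/2)^4
    let f : ℝ → ℝ := fun t => ‖G.eval ((1 + (t:ℂ))^4)‖
    let g : ℝ → ℝ := fun t => t^(m+1) * ((8 * K)^(r+1) * t^2 * ‖(PB r).eval ((1 + (t:ℂ))^4)‖ + (8*K)^r * ‖(PB (r+1)).eval ((1 + (t:ℂ))^4)‖)
    have hf : Continuous f := by
      apply Continuous.norm
      exact G.continuous.comp (by fun_prop)
    have hg : Continuous g := by
      have c1 : Continuous fun t : ℝ => (PB r).eval ((1 + (t:ℂ))^4) := (PB r).continuous.comp (by fun_prop)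
      have c2 : Continuous fun t : ℝ => (PB (r+1)).eval ((1 + (t:ℂ))^4) := (PB (r+1)).continuous.comp (by fun_prop)
      fun_prop
    have hfg : ∀ t ∈ Set.Ioo (0:ℝ) (1/2), f t ≤ g t := by
      intro t ⟨ht0, ht1⟩
      set w : ℂ := 1 + (t:ℂ) with hw
      have hwt : ‖w - 1‖ = t := by
        rw [hw, add_sub_cancel_left, Complex.norm_real, Real.norm_of_nonneg ht0.le]
      have bd : ∀ r, ‖w * Bp r (w^4) - Ap r (w^4)‖ ≤ (8 * K)^r * t^(2*r+1) := by
        intro r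
        have := L3' r w t hwt.le ht1.le
        refine this.trans ?_
        rw [hwt, show (8 * K)^r * t^(2*r+1) = 8^r * ((K * t^2)^r * t) by rw [mul_pow, mul_pow, pow_succ, pow_mul]; ring]
        have h1 : 4 * t ^ 2 * (1 + t) ^ 6 / (1 - t) ^ 4 ≤ K * t^2 := by
          rw [div_le_iff₀ (by apply pow_pos; linarith)]
          calc 4 * t ^ 2 * (1 + t) ^ 6 ≤ 4 * t^2 * (1 + 1/2)^6 := by gcongr
            _ = K * t^2 * (1 - 1/2)^4 := by simp only [K]; ring
            _ ≤ K * t^2 * (1 - t)^4 := by gcongr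
        have h0 : 0 ≤ 4 * t ^ 2 * (1 + t) ^ 6 / (1 - t) ^ 4 := by
          apply div_nonneg (by positivity)
          apply pow_nonneg; linarith
        gcongr
      have e1 : (w^4 - 1)^k * G.eval (w^4) = (w * Bp (r+1) (w^4) - Ap (r+1) (w^4)) * Bp r (w^4) - (w * Bp r (w^4) - Ap r (w^4)) * Bp (r+1) (w^4) := by
        have := hDe (w^4)
        rw [hG, eval_mul, eval_pow] at this
        simp only [eval_sub, eval_X, eval_C] at this
        rw [this]; ring
      have e2 : t ^ k * ‖G.eval (w^4)‖ ≤ ‖(w^4 - 1)^k * G.eval (w^4)‖ := by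
        rw [norm_mul, norm_pow]
        have : t ≤ ‖w^4 - 1‖ := by
          have : w^4 - 1 = (((1+t)^4 - 1 : ℝ) : ℂ) := by rw [hw]; push_cast; ring
          rw [this, Complex.norm_real]
          refine le_trans ?_ (le_abs_self _)
          have : 0 < t^2 := by positivity
          have : 0 < t^3 := by positivity
          have : 0 < t^4 := by positivity
          nlinarith
        gcongr
      have e3 : t^k * ‖G.eval (w^4)‖ ≤ t^k * g t := by
        refine e2.trans ?_
        rw [e1]
        refine (norm_sub_le _ _).trans ?_
        rw [norm_mul, norm_mul]
        have b1 := mul_le_mul_of_nonneg_right (bd (r+1)) (norm_nonneg (Bp r (w^4)))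
        have b2 := mul_le_mul_of_nonneg_right (bd r) (norm_nonneg (Bp (r+1) (w^4)))
        refine (add_le_add b1 b2).trans (le_of_eq ?_)
        simp only [g]
        rw [hPB, hPB, ← hw, show 2 * (r+1) + 1 = k + (m+1) + 2 by omega, hm]
        ring
      exact le_of_mul_le_mul_left e3 (by positivity)
    have hlim : f 0 ≤ g 0 := by
      have t1 : Filter.Tendsto f (nhdsWithin 0 (Set.Ioi 0)) (nhds (f 0)) := hf.continuousWithinAt
      have t2 : Filter.Tendsto g (nhdsWithin 0 (Set.Ioi 0)) (nhds (g 0)) := hg.continuousWithinAt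
      apply le_of_tendsto_of_tendsto t1 t2
      filter_upwards [Ioo_mem_nhdsGT (show (0:ℝ) < 1/2 by norm_num)] with t ht
      exact hfg t ht
    simp [f, g] at hlim
    exact hlim
  have hG0 : G ≠ 0 := by rintro rfl; simp at hG1
  have hdeg2 : D.natDegree = k + G.natDegree := by
    rw [hG, natDegree_mul (pow_ne_zero _ (X_sub_C_ne_zero _)) hG0, natDegree_pow, natDegree_X_sub_C, mul_one]
  have hGd : G.natDegree = 0 := by omega
  obtain ⟨c, hc⟩ := natDegree_eq_zero.1 hGd
  rw [← hDe, hG, eval_mul, eval_pow, ← hc]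
  simp only [eval_sub, eval_X, eval_C]
  refine mul_ne_zero (pow_ne_zero _ (sub_ne_zero.2 hx)) ?_
  rw [← hc] at hG1
  simpa using hG1

theorem qq_le (m k c : ℕ) (h : c ≤ 4 * m + 4) : qq c k ≤ 8 ^ k * (m + k).choose k := by
  unfold qq
  apply Nat.div_le_of_le_mul
  calc 2 ^ k * (∏ i ∈ range k, (c + 4 * i)) ≤ 2 ^ k * (∏ i ∈ range k, (4 * (m + 1 + i))) := by
        apply Nat.mul_le_mul_left
        apply prod_le_prod'
        intro i _
        omega
    _ = 2 ^ k * (4 ^ k * (m+1).ascFactorial k) := by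
        rw [prod_mul_distrib, prod_const, card_range, Nat.ascFactorial_eq_prod_range]
    _ = k.factorial * (8 ^ k * (m + k).choose k) := by
        rw [Nat.ascFactorial_eq_factorial_mul_choose, show 8 = 2 * 4 by norm_num, mul_pow]; ring

theorem ee_le (r j : ℕ) (hj : j ≤ r) : ee r j ≤ 16 ^ r * 2 * r.choose j := by
  have h1 := qq_le j (r - j) (4 * j + 3) (by omega)
  have h2 := qq_le (r - j + 1) j (4 * (r - j) + 5) (by omega)
  have h3 : (r - j + 1 + j).choose j ≤ 2 ^ (r + 1) := by
    rw [show r - j + 1 + j = r + 1 by omega]; exact Nat.choose_le_two_pow _ _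
  rw [show j + (r - j) = r by omega, Nat.choose_symm hj] at h1
  unfold ee
  calc _ ≤ (8 ^ (r - j) * r.choose j) * (8 ^ j * 2 ^ (r+1)) := by
        apply Nat.mul_le_mul h1
        exact h2.trans (Nat.mul_le_mul_left _ h3)
    _ = (8 ^ (r - j) * 8 ^ j) * 2 ^ r * 2 * r.choose j := by ring
    _ = _ := by
      rw [← pow_add, show r - j + j = r by omega, ← mul_pow]
      norm_num

theorem ee_sum (r : ℕ) : ∑ j ∈ range (r+1), ee r j ≤ 2 * 32 ^ r := by
  calc _ ≤ ∑ j ∈ range (r+1), 16 ^ r * 2 * r.choose j := by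
        apply sum_le_sum; intro j hj; rw [mem_range] at hj; exact ee_le r j (by omega)
    _ = 16 ^ r * 2 * 2 ^ r := by rw [← mul_sum, Nat.sum_range_choose]
    _ = _ := by rw [show 32 = 16 * 2 by norm_num, mul_pow]; ring


theorem root_near (z : ℂ) (δ : ℝ) (h : ‖z^4 - 1‖ ≤ δ) :
    ∃ g : GaussianInt, (g:ℂ)^4 = 1 ∧ ‖(g:ℂ)‖ = 1 ∧ ‖(g:ℂ) * z - 1‖ ≤ δ := by
  have key : ∀ x : ℂ, ∀ e : ℝ, ‖x^2 - 1‖ ≤ e → ‖x - 1‖ ≤ e ∨ ‖-x - 1‖ ≤ e := by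
    intro x e hx
    have h1 : ‖x^2 - 1‖ = ‖x - 1‖ * ‖-x - 1‖ := by
      rw [← norm_mul, ← norm_neg]; congr 1; ring
    have h2 : 2 ≤ ‖x - 1‖ + ‖-x - 1‖ := by
      have := norm_add_le (x - 1) (-x - 1)
      rw [show x - 1 + (-x - 1) = -2 by ring] at this
      simpa using this
    by_cases hc : 1 ≤ ‖x - 1‖
    · right
      nlinarith [norm_nonneg (-x - 1)]
    · left
      nlinarith [norm_nonneg (x - 1)]
  have hI : ((⟨0, 1⟩ : GaussianInt) : ℂ) = Complex.I := by
    simp [GaussianInt.toComplex_def]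
  have h4 : Complex.I ^ 4 = 1 := Complex.I_pow_four
  rcases key (z^2) δ (by rw [← pow_mul]; exact h) with h1 | h1
  · rcases key z δ h1 with h2 | h2
    · exact ⟨1, by simp, by simp, by simpa using h2⟩
    · exact ⟨-1, by simp; norm_num, by simp, by simpa using h2⟩
  · have h1' : ‖(Complex.I * z)^2 - 1‖ ≤ δ := by
      rw [mul_pow, Complex.I_sq]; simpa using h1
    rcases key _ δ h1' with h2 | h2
    · exact ⟨⟨0, 1⟩, by rw [hI, h4], by rw [hI]; simp, by rw [hI]; exact h2⟩
    · refine ⟨-⟨0, 1⟩, ?_, ?_, ?_⟩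
      · rw [map_neg, hI, Even.neg_pow (by decide), h4]
      · rw [map_neg, hI]; simp
      · rw [map_neg, hI]; simpa using h2

def Ah (R : Type*) [CommRing R] (r : ℕ) (a b : R) : R := ∑ j ∈ range (r+1), (ee r j : R) * a ^ (r-j) * b ^ j
def Bh (R : Type*) [CommRing R] (r : ℕ) (a b : R) : R := ∑ j ∈ range (r+1), (ee r (r-j) : R) * a ^ (r-j) * b ^ j

theorem Ah_eq (r : ℕ) (a b : ℂ) (ha : a ≠ 0) : Ah ℂ r a b = a ^ r * Ap r (b / a) := by
  unfold Ah Ap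
  rw [mul_sum]
  apply sum_congr rfl; intro j hj
  rw [mem_range] at hj
  have : a ^ r = a ^ (r - j) * a ^ j := by rw [← pow_add]; congr 1; omega
  rw [this, div_pow]
  field_simp

theorem Bh_eq (r : ℕ) (a b : ℂ) (ha : a ≠ 0) : Bh ℂ r a b = a ^ r * Bp r (b / a) := by
  unfold Bh Bp
  rw [mul_sum]
  apply sum_congr rfl; intro j hj
  rw [mem_range] at hj
  have : a ^ r = a ^ (r - j) * a ^ j := by rw [← pow_add]; congr 1; omega
  rw [this, div_pow]
  field_simp

theorem Bh_norm (r : ℕ) (a b : ℂ) (ha : ‖a‖ = 169) (hb : ‖b‖ = 169) : ‖Bh ℂ r a b‖ ≤ 2 * 5408 ^ r := by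
  unfold Bh
  calc _ ≤ ∑ j ∈ range (r+1), ‖(ee r (r-j) : ℂ) * a ^ (r-j) * b ^ j‖ := norm_sum_le _ _
    _ = ∑ j ∈ range (r+1), (ee r (r-j) : ℝ) * 169 ^ r := by
      apply sum_congr rfl; intro j hj
      rw [mem_range] at hj
      rw [norm_mul, norm_mul, norm_pow, norm_pow, ha, hb, mul_assoc, ← pow_add, show r - j + j = r by omega]
      simp
    _ = (∑ j ∈ range (r+1), ee r j : ℕ) * 169 ^ r := by
      rw [← sum_mul, ← sum_range_reflect (fun j => ee r j)]
      push_cast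
      congr 1
    _ ≤ (2 * 32 ^ r : ℕ) * 169 ^ r := by
      gcongr
      exact ee_sum r
    _ = _ := by push_cast; rw [mul_assoc, ← mul_pow]; norm_num

theorem exists_omega (w : ℂ) (hw : ‖w - 1‖ ≤ 0.0084) : ∃ o : ℂ, o ^ 4 = w ∧ ‖o - 1‖ ≤ 0.0022 := by
  obtain ⟨z, hz⟩ := IsAlgClosed.exists_pow_nat_eq w (show 0 < 4 by norm_num)
  obtain ⟨g, hg, -, h⟩ := root_near z 0.0084 (by rw [hz]; exact hw)
  refine ⟨g * z, by rw [mul_pow, hg, one_mul, hz], ?_⟩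
  set o := (g:ℂ) * z with ho
  have ho4 : o ^ 4 = w := by rw [ho, mul_pow, hg, one_mul, hz]
  have e : w - 1 = (o - 1) * (4 + (o - 1) * (6 + 4 * (o - 1) + (o - 1)^2)) := by rw [← ho4]; ring
  have b1 : ‖6 + 4 * (o - 1) + (o - 1)^2‖ ≤ 7 := by
    calc _ ≤ ‖(6:ℂ)‖ + ‖4 * (o - 1)‖ + ‖(o-1)^2‖ := norm_add₃_le
      _ = 6 + 4 * ‖o - 1‖ + ‖o - 1‖^2 := by simp
      _ ≤ 6 + 4 * 0.0084 + 0.0084 ^ 2 := by gcongr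
      _ ≤ 7 := by norm_num
  have b2 : ‖(o - 1) * (6 + 4 * (o - 1) + (o - 1)^2)‖ ≤ 0.0084 * 7 := by
    rw [norm_mul]; gcongr
  have b3 : 3.94 ≤ ‖4 + (o - 1) * (6 + 4 * (o - 1) + (o - 1)^2)‖ := by
    have := norm_sub_norm_le (4:ℂ) (-((o - 1) * (6 + 4 * (o - 1) + (o - 1)^2)))
    rw [norm_neg, sub_neg_eq_add] at this
    simp only [Complex.norm_ofNat] at this
    linarith
  rw [e, norm_mul] at hw
  nlinarith [norm_nonneg (o - 1)]

theorem gauss_norm (g : GaussianInt) (h : (g:ℂ) ≠ 0) : 1 ≤ ‖(g:ℂ)‖ := by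
  have h1 : g ≠ 0 := by rintro rfl; simp at h
  have h2 : 0 < g.norm := GaussianInt.norm_pos.2 h1
  have h3 : (1:ℝ) ≤ (g.norm : ℝ) := by exact_mod_cast h2
  rw [GaussianInt.intCast_real_norm, Complex.normSq_eq_norm_sq] at h3
  nlinarith [norm_nonneg (g:ℂ)]

theorem thue_large (a b : ℤ) (s : ℤ) (hs : s = 1 ∨ s = -1)
    (hF : a^4 + 4*a^3*b - 6*a^2*b^2 - 4*a*b^3 + b^4 = s) : a^2 + b^2 ≤ 36 ^ 20 := by
  by_contra hlarge
  push Not at hlarge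
  -- Gaussian integers
  let X : GaussianInt := ⟨a, b⟩
  let X' : GaussianInt := ⟨a, -b⟩
  let E : GaussianInt := ⟨3, 2⟩
  let E' : GaussianInt := ⟨3, -2⟩
  let A1 : GaussianInt := ⟨-119, 120⟩
  let B1 : GaussianInt := ⟨-120, 119⟩
  have i2 := Complex.I_sq
  have i4 := Complex.I_pow_four
  have cX : (X:ℂ) = a + b * Complex.I := by simp [X, GaussianInt.toComplex_def]
  have cX' : (X':ℂ) = a - b * Complex.I := by simp [X', GaussianInt.toComplex_def]; ring
  have cE : (E:ℂ) = 3 + 2 * Complex.I := by simp [E, GaussianInt.toComplex_def]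
  have cE' : (E':ℂ) = 3 - 2 * Complex.I := by simp [E', GaussianInt.toComplex_def]; ring
  have cA : (A1:ℂ) = -119 + 120 * Complex.I := by simp [A1, GaussianInt.toComplex_def]
  have cB : (B1:ℂ) = -120 + 119 * Complex.I := by simp [B1, GaussianInt.toComplex_def]
  have nX2 : ‖(X:ℂ)‖^2 = (a:ℝ)^2 + (b:ℝ)^2 := by
    rw [← Complex.normSq_eq_norm_sq, cX, Complex.normSq_apply]; simp; ring
  have nX'2 : ‖(X':ℂ)‖^2 = (a:ℝ)^2 + (b:ℝ)^2 := by
    rw [← Complex.normSq_eq_norm_sq, cX', Complex.normSq_apply]; simp; ring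
  have nX' : ‖(X':ℂ)‖ = ‖(X:ℂ)‖ := by
    rw [← sq_eq_sq₀ (norm_nonneg _) (norm_nonneg _), nX2, nX'2]
  have nE2 : ‖(E:ℂ)‖^2 = 13 := by
    rw [← Complex.normSq_eq_norm_sq, cE, Complex.normSq_apply]; simp; norm_num
  have nE'2 : ‖(E':ℂ)‖^2 = 13 := by
    rw [← Complex.normSq_eq_norm_sq, cE', Complex.normSq_apply]; simp; norm_num
  have nE : ‖(E:ℂ)‖ ≤ 3.7 := by nlinarith [norm_nonneg (E:ℂ)]
  have nE' : ‖(E':ℂ)‖ ≤ 3.7 := by nlinarith [norm_nonneg (E':ℂ)]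
  have nA : ‖(A1:ℂ)‖ = 169 := by
    rw [← sq_eq_sq₀ (norm_nonneg _) (by norm_num), ← Complex.normSq_eq_norm_sq, cA, Complex.normSq_apply]; simp; norm_num
  have nB : ‖(B1:ℂ)‖ = 169 := by
    rw [← sq_eq_sq₀ (norm_nonneg _) (by norm_num), ← Complex.normSq_eq_norm_sq, cB, Complex.normSq_apply]; simp; norm_num
  have n1i : ‖(1 + Complex.I)‖ ≤ 1.4143 := by
    have : ‖(1 + Complex.I)‖^2 = 2 := by
      rw [← Complex.normSq_eq_norm_sq, Complex.normSq_apply]; simp; norm_num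
    nlinarith [norm_nonneg (1 + Complex.I)]
  have A0 : (A1:ℂ) ≠ 0 := by rw [← norm_pos_iff, nA]; norm_num
  have E0 : (E:ℂ) ≠ 0 := by intro h; rw [h] at nE2; norm_num at nE2
  have E'0 : (E':ℂ) ≠ 0 := by intro h; rw [h] at nE'2; norm_num at nE'2
  have AE : (A1:ℂ) = E^4 := by
    rw [cA, cE]; linear_combination (-216 - 96 * Complex.I - 16 * (Complex.I^2 - 1)) * i2
  have BE : (B1:ℂ) = -Complex.I * E'^4 := by
    rw [cB, cE']; ring_nf; simp only [i2, i4, show Complex.I^3 = -Complex.I by rw [pow_succ, i2]; ring, show Complex.I^5 = Complex.I by rw [pow_succ, i4]; ring]; ring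
  have hH : (36:ℝ)^10 < ‖(X:ℂ)‖ := by
    have : ((36:ℝ)^10)^2 < ‖(X:ℂ)‖^2 := by
      rw [nX2, ← pow_mul]; exact_mod_cast hlarge
    exact lt_of_pow_lt_pow_left₀ 2 (norm_nonneg _) this
  set H : ℝ := ‖(X:ℂ)‖ with hHdef
  have H0 : 0 < H := lt_trans (by positivity) hH
  have X0 : (X:ℂ) ≠ 0 := norm_pos_iff.1 H0
  -- omega
  have hw1 : ((B1:ℂ) / A1) - 1 = -(1 + Complex.I) / A1 := by
    field_simp; rw [cA, cB]; ring
  have hw : ‖((B1:ℂ) / A1) - 1‖ ≤ 0.0084 := by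
    rw [hw1, norm_div, norm_neg, nA, div_le_iff₀ (by norm_num)]
    linarith
  have hwne : (B1:ℂ) / A1 ≠ 1 := by
    intro h
    rw [h, sub_self] at hw1
    rw [eq_comm, div_eq_zero_iff, neg_eq_zero] at hw1
    rcases hw1 with h1 | h1
    · have := congrArg Complex.re h1; simp at this
    · exact A0 h1
  obtain ⟨o, ho4, ho⟩ := exists_omega _ hw
  have hL : ∀ r, ‖o * Bh ℂ r A1 B1 - Ah ℂ r A1 B1‖ ≤ (1/36)^r * 0.0022 := by
    intro r
    rw [Ah_eq _ _ _ A0, Bh_eq _ _ _ A0, show ∀ x y z : ℂ, o * (x * y) - x * z = x * (o * y - z) by intros; ring,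
      norm_mul, norm_pow, nA, ← ho4]
    have h1 := L3' r o 0.0022 ho (by norm_num)
    calc _ ≤ (169:ℝ) ^ r * (8 ^ r * ((4 * (0.0022:ℝ)^2 * (1 + 0.0022)^6 / (1 - 0.0022)^4) ^ r * 0.0022)) := by
          gcongr
          refine h1.trans ?_
          gcongr
      _ = (169 * 8 * (4 * 0.0022^2 * (1 + 0.0022)^6 / (1 - 0.0022)^4)) ^ r * 0.0022 := by
          rw [mul_pow, mul_pow]; ring
      _ ≤ _ := by
          gcongr
          norm_num
  -- closeness of X
  have hX4 : (X:ℂ)^4 + Complex.I * X'^4 = s * (1 + Complex.I) := by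
    have hFc : (a:ℂ)^4 + 4*a^3*b - 6*a^2*b^2 - 4*a*b^3 + b^4 = s := by exact_mod_cast hF
    rw [cX, cX', ← hFc]; ring_nf; simp only [i2, i4, show Complex.I^3 = -Complex.I by rw [pow_succ, i2]; ring, show Complex.I^5 = Complex.I by rw [pow_succ, i4]; ring]; ring
  have hz : (o * E * X' / (E' * X))^4 - 1 = -(s * (1 + Complex.I)) / X^4 := by
    rw [div_pow, mul_pow, mul_pow, ho4, mul_pow, ← hX4, AE, BE]
    field_simp
    ring
  have hz2 : ‖(o * E * X' / (E' * X))^4 - 1‖ ≤ 1.4143 / H^4 := by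
    rw [hz, norm_div, norm_neg, norm_mul, norm_pow]
    have : ‖(s:ℂ)‖ = 1 := by rcases hs with rfl | rfl <;> simp
    rw [this, one_mul]
    gcongr
  obtain ⟨g, -, hg1, hg⟩ := root_near _ _ hz2
  set η : ℂ := (g:ℂ) * (o * E * X' / (E' * X)) - 1 with hη
  have hη2 : (g:ℂ) * o * E * X' = (1 + η) * (E' * X) := by
    rw [hη]; field_simp; ring
  -- linear form
  let Δ : ℕ → GaussianInt := fun r => Bh GaussianInt r A1 B1 * X * E' - g * Ah GaussianInt r A1 B1 * X' * E
  have hmA : ∀ r, ((Ah GaussianInt r A1 B1 : GaussianInt) : ℂ) = Ah ℂ r A1 B1 := by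
    intro r; unfold Ah; rw [map_sum]; simp
  have hmB : ∀ r, ((Bh GaussianInt r A1 B1 : GaussianInt) : ℂ) = Bh ℂ r A1 B1 := by
    intro r; unfold Bh; rw [map_sum]; simp
  have hΔ : ∀ r, ((Δ r : GaussianInt) : ℂ) = Bh ℂ r A1 B1 * X * E' - g * Ah ℂ r A1 B1 * X' * E := by
    intro r; simp only [Δ, map_sub, map_mul, hmA, hmB]
  have hΔ2 : ∀ r, ((Δ r : GaussianInt) : ℂ) = - (η * E' * X * Bh ℂ r A1 B1) + g * X' * E * (o * Bh ℂ r A1 B1 - Ah ℂ r A1 B1) := by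
    intro r; rw [hΔ]; linear_combination (-Bh ℂ r A1 B1) * hη2
  have hΔn : ∀ r, ‖((Δ r : GaussianInt) : ℂ)‖ ≤ 1.4143 / H^4 * 3.7 * H * (2 * 5408^r) + 1 * H * 3.7 * ((1/36)^r * 0.0022) := by
    intro r
    rw [hΔ2]
    refine (norm_add_le _ _).trans ?_
    rw [norm_neg]
    simp only [norm_mul]
    rw [hg1, nX', ← hHdef]
    have := Bh_norm r A1 B1 nA nB
    have := hL r
    gcongr
  -- choose R
  obtain ⟨n, hn1, hn2⟩ := exists_nat_pow_near (x := H) (y := 36) (by linarith [show (1:ℝ) ≤ 36^10 by norm_num]) (by norm_num)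
  have hn10 : 10 ≤ n := by
    by_contra h
    have : (36:ℝ)^(n+1) ≤ 36^10 := pow_le_pow_right₀ (by norm_num) (by omega)
    linarith
  have hsmall : ∀ r, n + 1 ≤ r → r ≤ n + 2 → ‖((Δ r : GaussianInt) : ℂ)‖ < 1 := by
    intro r hr1 hr2
    refine (hΔn r).trans_lt ?_
    have t1 : 1 * H * 3.7 * ((1/36)^r * 0.0022) ≤ 0.01 := by
      have : (36:ℝ)^(n+1) ≤ 36^r := pow_le_pow_right₀ (by norm_num) hr1
      have h36 : H ≤ 36^r := by linarith
      have : H * (1/36)^r ≤ 1 := by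
        rw [one_div, inv_pow, ← div_eq_mul_inv, div_le_one (by positivity)]; exact h36
      nlinarith
    have t2 : 1.4143 / H^4 * 3.7 * H * (2 * 5408^r) ≤ 0.9 := by
      have e : 1.4143 / H^4 * 3.7 * H * (2 * 5408^r) = 1.4143 * 3.7 * 2 * 5408^r / H^3 := by field_simp
      rw [e, div_le_iff₀ (by positivity)]
      have h1 : (5408:ℝ)^r ≤ 5408^(n+2) := pow_le_pow_right₀ (by norm_num) hr2
      have h2 : ((36:ℝ)^n)^3 ≤ H^3 := by gcongr
      have h3 : (12 * 5408^2 : ℝ) * 5408^n ≤ (36^n)^3 := by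
        obtain ⟨m, rfl⟩ := Nat.exists_eq_add_of_le hn10
        rw [← pow_mul, mul_comm (10+m) 3, pow_mul, pow_add, pow_add]
        have : (5408:ℝ)^m ≤ (36^3)^m := by gcongr; norm_num
        calc (12 * 5408^2 : ℝ) * (5408^10 * 5408^m) = (12 * 5408^2 * 5408^10) * 5408^m := by ring
          _ ≤ ((36^3)^10) * (36^3)^m := by
            apply mul_le_mul _ this (by positivity) (by positivity)
            norm_num
      have h4 : (5408:ℝ)^(n+2) = 5408^2 * 5408^n := by rw [pow_add]; ring
      nlinarith
    linarith
  have hzero : ∀ r, n + 1 ≤ r → r ≤ n + 2 → ((Δ r : GaussianInt) : ℂ) = 0 := by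
    intro r hr1 hr2
    by_contra h
    exact absurd (gauss_norm _ h) (not_le.2 (hsmall r hr1 hr2))
  have z1 := hzero (n+1) le_rfl (by omega)
  have z2 := hzero (n+1+1) (by omega) (by omega)
  rw [hΔ, Ah_eq _ _ _ A0, Bh_eq _ _ _ A0] at z1 z2
  have hd := det_ne (n+1) _ hwne
  apply hd
  have P0 : (A1:ℂ)^(n+1) * (A1:ℂ)^(n+1+1) * ((X:ℂ) * E') ≠ 0 := by
    refine mul_ne_zero (mul_ne_zero (pow_ne_zero _ A0) (pow_ne_zero _ A0)) (mul_ne_zero X0 E'0)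
  apply mul_left_cancel₀ P0
  rw [mul_zero]
  linear_combination (A1:ℂ)^(n+1) * Ap (n+1) (B1/A1) * z2 - (A1:ℂ)^(n+1+1) * Ap (n+1+1) (B1/A1) * z1


def pl : ℕ → ℕ × ℕ
  | 0 => (1, 1)
  | k + 1 => (3 * (pl k).1 + 4 * (pl k).2, 2 * (pl k).1 + 3 * (pl k).2)

theorem pl_all : ∀ z x : ℕ, x^2 + 1 = 2 * z^2 → ∃ k, pl k = (x, z) := by
  intro z
  induction z using Nat.strong_induction_on with
  | _ z ih =>
    intro x h
    have hz0 : 0 < z := by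
      rcases Nat.eq_zero_or_pos z with h0 | h0
      · subst h0; simp at h
      · exact h0
    rcases Nat.lt_or_ge z 3 with h3 | h3
    · interval_cases z
      · have : x = 1 := by nlinarith
        subst this; exact ⟨0, rfl⟩
      · have : x < 3 := by nlinarith
        interval_cases x <;> simp at h
    · have h1 : z < x := by nlinarith
      have h2 : 4 * z ≤ 3 * x := by nlinarith
      have h4 : 2 * x ≤ 3 * z := by nlinarith
      obtain ⟨x', hx'⟩ := Nat.exists_eq_add_of_le h2
      obtain ⟨z', hz'⟩ := Nat.exists_eq_add_of_le h4
      have ex : x = 3 * x' + 4 * z' := by omega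
      have ez : z = 2 * x' + 3 * z' := by omega
      have h5 : x'^2 + 1 = 2 * z'^2 := by rw [ex, ez] at h; nlinarith
      obtain ⟨k, hk⟩ := ih z' (by omega) x' h5
      exact ⟨k + 1, by simp [pl, hk, ex, ez]⟩

theorem pl_grow (k : ℕ) : 5 ^ k ≤ (pl k).2 ∧ (pl k).2 ≤ (pl k).1 := by
  induction k with
  | zero => simp [pl]
  | succ k ih => simp only [pl, pow_succ]; omega

theorem pl_sieve : ∀ k < 90, k = 0 ∨ k = 3 ∨
    ∃ p ∈ [3, 5, 7, 8, 11, 13, 17, 19, 23, 29, 31, 37, 41, 43, 47, 53, 59, 61], ∀ a < p, a * a % p ≠ (pl k).2 % p := by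
  decide +kernel

theorem ljunggren (x y : ℕ) (h : x^2 + 1 = 2 * y^4) : y = 1 ∨ y = 13 := by
  have hodd : x % 2 = 1 := by
    have : (x^2 + 1) % 2 = 0 := by omega
    rcases Nat.mod_two_eq_zero_or_one x with h0 | h0
    · simp [Nat.add_mod, Nat.pow_mod, h0] at this
    · exact h0
  obtain ⟨t, ht⟩ : ∃ t, x = 2 * t + 1 := ⟨x / 2, by omega⟩
  have hz : ((t:ℤ) + 1)^2 + (-t)^2 = ((y:ℤ)^2)^2 := by
    have : ((x:ℤ)^2 + 1) = 2 * (y:ℤ)^4 := by exact_mod_cast h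
    rw [ht] at this; push_cast at this
    nlinarith
  have hcop : Int.gcd ((t:ℤ) + 1) (-t) = 1 := by
    rw [← Int.isCoprime_iff_gcd_eq_one]
    exact ⟨1, 1, by ring⟩
  have hp : PythagoreanTriple ((t:ℤ)+1) (-t) ((y:ℤ)^2) := by
    unfold PythagoreanTriple; nlinarith
  obtain ⟨m, n, hmn, hy, hg, -⟩ := PythagoreanTriple.coprime_classification.1 ⟨hp, hcop⟩
  have h1 : m^2 - n^2 + 2 * m * n = 1 := by
    rcases hmn with ⟨h1, h2⟩ | ⟨h1, h2⟩ <;> linarith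
  have y0 : 0 < (y:ℤ) := by
    rcases Nat.eq_zero_or_pos y with h0 | h0
    · subst h0; simp at h
    · exact_mod_cast h0
  have hy' : (y:ℤ)^2 = m^2 + n^2 := by
    rcases hy with h2 | h2
    · exact h2
    · nlinarith [sq_nonneg m, sq_nonneg n]
  have hp2 : PythagoreanTriple m n (y:ℤ) := by
    unfold PythagoreanTriple; nlinarith
  obtain ⟨a, b, hab, hyab, -, -⟩ := PythagoreanTriple.coprime_classification.1 ⟨hp2, hg⟩
  have hyab' : (y:ℤ) = a^2 + b^2 := by
    rcases hyab with h2 | h2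
    · exact h2
    · nlinarith [sq_nonneg a, sq_nonneg b]
  have hle : (y:ℤ) ≤ 36 ^ 20 := by
    rw [hyab']
    rcases hab with ⟨h2, h3⟩ | ⟨h2, h3⟩
    · apply thue_large a b 1 (Or.inl rfl)
      rw [h2, h3] at h1; linear_combination h1
    · have := thue_large a (-b) (-1) (Or.inr rfl) (by rw [h2, h3] at h1; linear_combination -h1)
      simpa using this
  have hle' : y ≤ 36 ^ 20 := by exact_mod_cast hle
  obtain ⟨k, hk⟩ := pl_all (y^2) x (by rw [h]; ring)
  have hgr := (pl_grow k).1
  rw [hk] at hgr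
  simp only at hgr
  have hk90 : k < 90 := by
    by_contra hc
    have h1 : 5 ^ 90 ≤ 5 ^ k := Nat.pow_le_pow_right (by norm_num) (by omega)
    have h2 : y ^ 2 ≤ (36 ^ 20) ^ 2 := Nat.pow_le_pow_left hle' 2
    have h3 : (36 ^ 20) ^ 2 < 5 ^ 90 := by norm_num
    omega
  rcases pl_sieve k hk90 with h0 | h0 | ⟨p, hp, hpa⟩
  · subst h0
    simp [pl] at hk
    left
    nlinarith [hk.2]
  · subst h0
    simp [pl] at hk
    right
    nlinarith [hk.2]
  · exfalso
    have hp0 : 0 < p := by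
      rcases Nat.eq_zero_or_pos p with h0 | h0
      · subst h0; simp at hp
      · exact h0
    apply hpa (y % p) (Nat.mod_lt _ hp0)
    rw [hk, ← Nat.mul_mod, sq]

/-- The only integral points `(X, Y)` on `Y^2 = X^3 - 2 X` with `Y > 0` are
`(-1, 1)`, `(2, 2)` and `(338, 6214)`, and none of these yields an integer `d` with
`3 t^2 - 4 d = 1` where `X = -2 t`; that is, there is no integer solution
`(t, c, d)` with `c ≠ 0`, `c^2 = -2 t^3 + t` and `3 t^2 - 4 d = 1`. -/
theorem k_eq_one_case :
    (∀ X Y : ℤ, Y ^ 2 = X ^ 3 - 2 * X → 0 < Y →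
      (X, Y) = (-1, 1) ∨ (X, Y) = (2, 2) ∨ (X, Y) = (338, 6214)) ∧
    ¬ ∃ t c d : ℤ, c ≠ 0 ∧ c ^ 2 = -2 * t ^ 3 + t ∧ 3 * t ^ 2 - 4 * d = 1 := by
  constructor
  · intro X Y h hY
    have hpos : 0 < X * (X^2 - 2) := by nlinarith [sq_pos_of_pos hY]
    rcases lt_or_ge X 2 with hX | hX
    · left
      have : -2 < X := by
        by_contra hc
        have : X ≤ -2 := by omega
        nlinarith
      have : X = -1 := by
        interval_cases X <;> simp at hpos ⊢
      subst this
      have : Y = 1 := by nlinarith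
      rw [this]
    · right
      rcases Int.even_or_odd' X with ⟨u, hu | hu⟩
      · have hYe : Even Y := by
          have : Even (Y^2) := by
            rw [h, hu]; exact ⟨4 * u^3 - 2 * u, by ring⟩
          exact (Int.even_pow.1 this).1
        obtain ⟨v, hv⟩ := hYe
        have hv2 : u * (2 * u^2 - 1) = v^2 := by
          rw [hu, hv] at h; nlinarith
        have u1 : 1 ≤ u := by omega
        have hc : Int.gcd u (2 * u^2 - 1) = 1 := by
          rw [← Int.isCoprime_iff_gcd_eq_one]
          exact ⟨2 * u, -1, by ring⟩
        obtain ⟨a, ha⟩ := Int.sq_of_gcd_eq_one hc hv2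
        obtain ⟨b, hb⟩ := Int.sq_of_gcd_eq_one (by rw [Int.gcd_comm]; exact hc) (by rw [mul_comm]; exact hv2)
        have ha' : u = a^2 := by
          rcases ha with h1 | h1
          · exact h1
          · nlinarith [sq_nonneg a]
        have hb' : 2 * u^2 - 1 = b^2 := by
          rcases hb with h1 | h1
          · exact h1
          · nlinarith [sq_nonneg b]
        have hl : b.natAbs^2 + 1 = 2 * a.natAbs^4 := by
          zify
          rw [sq_abs, show (|a|)^4 = ((|a|)^2)^2 by ring, sq_abs, ← hb', ha']
          ring
        have hu2 : u = (a.natAbs:ℤ)^2 := by rw [ha']; simp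
        rcases ljunggren _ _ hl with h1 | h1
        · left
          rw [h1] at hu2
          norm_num at hu2
          subst hu2
          rw [hu] at h
          have : Y = 2 := by nlinarith
          rw [hu, this]; norm_num
        · right
          rw [h1] at hu2
          norm_num at hu2
          subst hu2
          rw [hu] at h
          have : Y = 6214 := by nlinarith
          rw [hu, this]; norm_num
      · exfalso
        have hc : Int.gcd (X^2 - 2) X = 1 := by
          rw [← Int.isCoprime_iff_gcd_eq_one]
          exact ⟨u, 1 - u * X, by rw [hu]; ring⟩
        obtain ⟨b, hb⟩ := Int.sq_of_gcd_eq_one hc (c := Y) (by rw [h]; ring)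
        rcases hb with h1 | h1
        · have hbo : Odd (b^2) := by
            rw [← h1, hu]; exact ⟨2 * u^2 + 2 * u - 1, by ring⟩
          obtain ⟨c, hc⟩ : Odd b := by
            rcases Int.even_or_odd b with h2 | h2
            · exact absurd hbo (by rw [Int.not_odd_iff_even]; exact h2.pow_of_ne_zero (by norm_num))
            · exact h2
          rw [hu, hc] at h1
          have : 4 * (u^2 + u - c^2 - c) = 2 := by linarith
          omega
        · nlinarith [sq_nonneg b]
  · rintro ⟨t, c, d, -, -, h⟩
    rcases Int.even_or_odd' t with ⟨u, hu | hu⟩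
    · subst hu; ring_nf at h; omega
    · subst hu; ring_nf at h; omega
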